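/- arXiv:2203.11577 — 8 statements merged into one kernel-verified Lean document; each statement's English description precedes it below -/
import Mathlib

section
/- For every integer n ≥ 1, the pointwise topology on End(ωKₙ) is a Polish semigroup topology, and it is the unique Polish semigroup topology on End(ωKₙ). -/
variable {G : Type*}

/-- The extension property characterising the random graph: for all disjoint
finite sets `U`, `V` of vertices there is a vertex outside `U ∪ V` adjacent to
everything in `U` and to nothing in `V`. -/
def ExtensionProperty (adj : G → G → Prop) : Prop :=
  ∀ U V : Finset G, (∀ x ∈ U, x ∉ V) →
    ∃ w : G, w ∉ U ∧ w ∉ V ∧ (∀ u ∈ U, adj w u) ∧ (∀ v ∈ V, ¬ adj w v)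

/-- The endomorphism monoid of the graph `(G, adj)`, as a set of functions. -/
def graphEnd (adj : G → G → Prop) : Set (G → G) :=
  {f : G → G | ∀ x y : G, adj x y → adj (f x) (f y)}

theorem graphEnd_comp (adj : G → G → Prop) :
    ∀ f ∈ graphEnd adj, ∀ g ∈ graphEnd adj, g ∘ f ∈ graphEnd adj :=
  fun _ hf _ hg x y h => hg _ _ (hf x y h)

/-- The topology of pointwise convergence on a set `S` of self-maps of `X`,
where `X` carries the discrete topology. -/
def pointwiseTop (X : Type*) (S : Set (X → X)) : TopologicalSpace ↥S :=
  TopologicalSpace.generateFrom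
    {U : Set ↥S | ∃ x y : X, U = {f : ↥S | f.1 x = y}}

/-- `τ` is a Polish semigroup topology on the set `S` of self-maps of `X`
(a semigroup under composition in diagrammatic order, `hS` witnessing closure
under composition): `τ` is Polish and composition is continuous. -/
def IsPolishSemigroupTop {X : Type*} {S : Set (X → X)}
    (hS : ∀ f ∈ S, ∀ g ∈ S, g ∘ f ∈ S) (τ : TopologicalSpace ↥S) : Prop :=
  @PolishSpace ↥S τ ∧
    @Continuous (↥S × ↥S) ↥S (@instTopologicalSpaceProd ↥S ↥S τ τ) τ
      (fun p => ⟨p.2.1 ∘ p.1.1, hS p.1.1 p.1.2 p.2.1 p.2.2⟩)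

/-- The adjacency relation of the graph `ωKₙ`: the disjoint union of countably
many copies of the complete graph on `n` vertices (no loops). -/
def omegaKn (n : ℕ) : (ℕ × Fin n) → (ℕ × Fin n) → Prop :=
  fun u v => u.1 = v.1 ∧ u ≠ v

open Filter Topology MeasureTheory

/-- A Borel map `h` from a Baire topological group to a second countable space is continuous as
soon as every left translation of the group is intertwined by `h` with a continuous self-map. -/
theorem continuous_of_borel_of_leftTranslation {Γ M : Type*} [Group Γ] [TopologicalSpace Γ]
    [IsTopologicalGroup Γ] [BaireSpace Γ] [SequentialSpace Γ] [TopologicalSpace M]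
    [SecondCountableTopology M] {h : Γ → M}
    (hmeas : ∀ U : Set M, IsOpen U → MeasurableSet[borel Γ] (h ⁻¹' U))
    (htrans : ∀ g, ∃ L : M → M, Continuous L ∧ ∀ x, h (g * x) = L (h x)) :
    Continuous h := by
  borelize Γ
  have hB := TopologicalSpace.isBasis_countableBasis M
  have hopen : ∀ U : TopologicalSpace.countableBasis M,
      ∃ O : Set Γ, IsOpen O ∧ h ⁻¹' U.1 =ᶠ[residual Γ] O := fun U =>
    (hmeas U.1 (hB.isOpen U.2)).residualEq_isOpen
  choose O hO hOU using hopen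
  have hC : ∀ᶠ x in residual Γ, ∀ U : TopologicalSpace.countableBasis M,
      (x ∈ h ⁻¹' U.1 ↔ x ∈ O U) :=
    eventually_countable_forall.2 fun U => eventuallyEq_set.1 (hOU U)
  have htr : ∀ y : Γ, ∀ᶠ g in residual Γ, ∀ U : TopologicalSpace.countableBasis M,
      (g * y ∈ h ⁻¹' U.1 ↔ g * y ∈ O U) := fun y =>
    (tendsto_residual_of_isOpenMap (continuous_mul_const y) (isOpenMap_mul_right y)).eventually hC
  refine continuous_iff_seqContinuous.2 fun x p hx => ?_
  obtain ⟨g, hgp, hg⟩ := (dense_of_mem_residual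
    ((eventually_countable_forall.2 fun k => htr (x k)).and (htr p))).nonempty
  have hlim : Tendsto (fun k => h (g * x k)) atTop (𝓝 (h (g * p))) := by
    refine (hB.nhds_hasBasis).tendsto_right_iff.2 fun U hU => ?_
    have hp : g * p ∈ O ⟨U, hU.1⟩ := (hg ⟨U, hU.1⟩).1 hU.2
    filter_upwards [(hx.const_mul g).eventually ((hO _).mem_nhds hp)] with k hk
    exact (hgp k ⟨U, hU.1⟩).2 hk
  obtain ⟨L, hL, hLh⟩ := htrans g⁻¹
  have key : ∀ y, h y = L (h (g * y)) := fun y => by rw [← hLh, inv_mul_cancel_left]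
  have := (hL.tendsto (h (g * p))).comp hlim
  rw [← key] at this
  exact this.congr fun k => (key (x k)).symm

theorem pointwiseTop_eq_subtype {X : Type*} [TopologicalSpace X] [DiscreteTopology X]
    (S : Set (X → X)) : pointwiseTop X S = instTopologicalSpaceSubtype := by
  apply le_antisymm
  · rw [← continuous_id_iff_le]
    let := pointwiseTop X S
    refine continuous_induced_rng.2 (continuous_pi fun x => continuous_discrete_rng.2 fun y => ?_)
    exact TopologicalSpace.isOpen_generateFrom_of_mem ⟨x, y, rfl⟩
  · refine le_generateFrom ?_
    rintro _ ⟨x, y, rfl⟩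
    have hx : Continuous fun f : S => f.1 x := (continuous_apply x).comp continuous_subtype_val
    exact (isOpen_discrete {y}).preimage hx

theorem isClosed_graphEnd {X : Type*} [TopologicalSpace X] [DiscreteTopology X]
    (adj : X → X → Prop) : IsClosed (graphEnd adj) := by
  simp only [graphEnd, Set.ofPred_forall]
  refine isClosed_iInter fun x => isClosed_iInter fun y => isClosed_iInter fun _ => ?_
  have hxy : Continuous fun f : X → X => (f x, f y) :=
    (continuous_apply x).prodMk (continuous_apply y)
  exact (isClosed_discrete {q : X × X | adj q.1 q.2}).preimage hxy

theorem isPolishSemigroupTop_pointwiseTop {X : Type*} [Countable X] (adj : X → X → Prop) :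
    IsPolishSemigroupTop (graphEnd_comp adj) (pointwiseTop X (graphEnd adj)) := by
  let : TopologicalSpace X := ⊥
  have : DiscreteTopology X := ⟨rfl⟩
  have : PolishSpace X := ⟨⟩
  rw [pointwiseTop_eq_subtype]
  refine ⟨(isClosed_graphEnd adj).polishSpace, ?_⟩
  refine continuous_induced_rng.2 (continuous_pi fun x => continuous_discrete_rng.2 fun y => ?_)
  refine isOpen_iff_mem_nhds.2 fun p hp => ?_
  have h₁ : Continuous fun q : graphEnd adj × graphEnd adj => q.1.1 x :=
    (continuous_apply x).comp (continuous_subtype_val.comp continuous_fst)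
  have h₂ : Continuous fun q : graphEnd adj × graphEnd adj => q.2.1 (p.1.1 x) :=
    (continuous_apply _).comp (continuous_subtype_val.comp continuous_snd)
  filter_upwards [((isOpen_discrete {p.1.1 x}).preimage h₁).mem_nhds rfl,
    ((isOpen_discrete {y}).preimage h₂).mem_nhds hp] with q hq₁ hq₂
  simp only [Set.mem_preimage, Set.mem_singleton_iff] at hq₁ hq₂ ⊢
  simp only [Function.comp_apply, hq₁, hq₂]

/-- The endomorphism of `ωKₙ` sending the `i`-th block to the `φ i`-th one through the
permutation `σ i`. -/
def omegaKnEnd {n : ℕ} (φ : ℕ → ℕ) (σ : ℕ → Equiv.Perm (Fin n)) : graphEnd (omegaKn n) :=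
  ⟨fun u => (φ u.1, σ u.1 u.2), by
    rintro ⟨i, a⟩ ⟨j, b⟩ ⟨hij, hne⟩
    obtain rfl : i = j := hij
    exact ⟨rfl, fun h => hne (by simpa using h)⟩⟩

@[simp]
theorem omegaKnEnd_apply {n : ℕ} (φ : ℕ → ℕ) (σ : ℕ → Equiv.Perm (Fin n)) (u : ℕ × Fin n) :
    (omegaKnEnd φ σ).1 u = (φ u.1, σ u.1 u.2) := rfl

theorem exists_eq_omegaKnEnd {n : ℕ} (hn : 1 ≤ n) (f : graphEnd (omegaKn n)) :
    ∃ φ σ, f = omegaKnEnd φ σ := by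
  have hblock : ∀ i a b, (f.1 (i, a)).1 = (f.1 (i, b)).1 := fun i a b => by
    by_cases hab : a = b
    · rw [hab]
    · exact (f.2 (i, a) (i, b) ⟨rfl, by simpa using hab⟩).1
  have hinj : ∀ i, Function.Injective fun a => (f.1 (i, a)).2 := fun i a b hab => by
    by_contra hne
    exact (f.2 (i, a) (i, b) ⟨rfl, by simpa using hne⟩).2 (Prod.ext (hblock i a b) hab)
  refine ⟨fun i => (f.1 (i, ⟨0, hn⟩)).1,
    fun i => Equiv.ofBijective _ (Finite.injective_iff_bijective.1 (hinj i)), ?_⟩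
  exact Subtype.ext (funext fun u => Prod.ext (hblock u.1 u.2 _) rfl)

/-- Every `T₁` topology on `End(ωKₙ)` with continuous translations refines the pointwise one. -/
theorem le_pointwiseTop_of_t1 {n : ℕ} (hn : 1 ≤ n) (τ : TopologicalSpace (graphEnd (omegaKn n)))
    (hT : @T1Space _ τ)
    (hτ : ∀ g k : graphEnd (omegaKn n), Continuous[τ, τ] fun f =>
      (⟨g.1 ∘ f.1 ∘ k.1, graphEnd_comp _ _ (graphEnd_comp _ _ k.2 _ f.2) _ g.2⟩ :
        graphEnd (omegaKn n))) :
    τ ≤ pointwiseTop (ℕ × Fin n) (graphEnd (omegaKn n)) := by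
  refine le_generateFrom ?_
  rintro _ ⟨⟨x, a⟩, ⟨y, b⟩, rfl⟩
  let := τ
  let g : graphEnd (omegaKn n) := omegaKnEnd (fun j => if j = y then 0 else 1) 1
  let k : graphEnd (omegaKn n) := omegaKnEnd (fun _ => x) 1
  let p : Fin 2 × Equiv.Perm (Fin n) → graphEnd (omegaKn n) :=
    fun q => omegaKnEnd (fun _ => q.1) (fun _ => q.2)
  have hF : IsClosed (p '' {q | ¬ (q.1 = 0 ∧ q.2 a = b)}) := (Set.toFinite _).isClosed
  convert (hF.preimage (hτ g k)).isOpen_compl using 1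
  ext f
  obtain ⟨φ, σ, rfl⟩ := exists_eq_omegaKnEnd hn f
  have hp : ∀ q, p q = ⟨g.1 ∘ (omegaKnEnd φ σ).1 ∘ k.1,
      graphEnd_comp _ _ (graphEnd_comp _ _ k.2 _ (omegaKnEnd φ σ).2) _ g.2⟩ ↔
      q = (if φ x = y then 0 else 1, σ x) := by
    rintro ⟨e, ρ⟩
    constructor
    · intro h
      have h' : ∀ c, ((e : ℕ), ρ c) = (if φ x = y then 0 else 1, σ x c) := fun c =>
        congrFun (congrArg Subtype.val h) (0, c)
      refine Prod.ext (Fin.ext ?_) (Equiv.ext fun c => (Prod.ext_iff.1 (h' c)).2)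
      have := (Prod.ext_iff.1 (h' a)).1
      simp only at this ⊢
      rw [this]
      split_ifs <;> rfl
    · intro h
      rw [h]
      refine Subtype.ext (funext fun u => ?_)
      simp only [p, g, k, omegaKnEnd_apply, Function.comp_apply, Pi.one_apply,
        Equiv.Perm.one_apply]
      split_ifs <;> rfl
  simp only [Set.mem_ofPred_eq, Set.mem_compl_iff, Set.mem_preimage, Set.mem_image, hp,
    exists_eq_right, not_not, omegaKnEnd_apply, Prod.mk.injEq]
  split_ifs with h <;> simp [h]

/-- The action of the product of countably many copies of `ℤ × Sₙ` on `ωKₙ`, whose blocks are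
indexed by `ℕ × ℤ`: the `i`-th factor shifts the blocks `(i, m)` and permutes their vertices. -/
def shiftEnd {n : ℕ} (e : ℕ ≃ ℕ × ℤ) (γ : ℕ → Multiplicative ℤ × Equiv.Perm (Fin n)) :
    graphEnd (omegaKn n) :=
  omegaKnEnd (fun j => e.symm ((e j).1, (γ (e j).1).1.toAdd + (e j).2)) fun j => (γ (e j).1).2

theorem shiftEnd_mul {n : ℕ} (e : ℕ ≃ ℕ × ℤ)
    (γ δ : ℕ → Multiplicative ℤ × Equiv.Perm (Fin n)) :
    shiftEnd e (γ * δ) = ⟨(shiftEnd e γ).1 ∘ (shiftEnd e δ).1,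
      graphEnd_comp _ _ (shiftEnd e δ).2 _ (shiftEnd e γ).2⟩ := by
  refine Subtype.ext (funext fun u => ?_)
  simp [shiftEnd, add_assoc]

theorem continuous_shiftEnd {n : ℕ} [TopologicalSpace (Equiv.Perm (Fin n))]
    [DiscreteTopology (Equiv.Perm (Fin n))] (e : ℕ ≃ ℕ × ℤ) :
    Continuous (shiftEnd (n := n) e) := by
  refine continuous_induced_rng.2 (continuous_pi fun u => ?_)
  have hfac : Continuous fun c : Multiplicative ℤ × Equiv.Perm (Fin n) =>
      (e.symm ((e u.1).1, c.1.toAdd + (e u.1).2), c.2 u.2) := continuous_of_discreteTopology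
  have hcoord : Continuous fun γ : ℕ → Multiplicative ℤ × Equiv.Perm (Fin n) => γ (e u.1).1 :=
    continuous_apply _
  exact hfac.comp hcoord

/-- Every endomorphism of `ωKₙ` factors through an automorphism `shiftEnd e γ`, with fixed outer
factors and with `γ` depending continuously on the endomorphism. -/
theorem exists_continuous_shiftEnd_factorization {n : ℕ} (hn : 1 ≤ n)
    [TopologicalSpace (Equiv.Perm (Fin n))] [DiscreteTopology (Equiv.Perm (Fin n))]
    (e : ℕ ≃ ℕ × ℤ) :
    ∃ (f₀ g₀ : graphEnd (omegaKn n))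
      (γ : graphEnd (omegaKn n) → ℕ → Multiplicative ℤ × Equiv.Perm (Fin n)),
      Continuous γ ∧ ∀ s, s.1 = f₀.1 ∘ (shiftEnd e (γ s)).1 ∘ g₀.1 := by
  choose φ σ hφσ using exists_eq_omegaKnEnd hn
  refine ⟨omegaKnEnd (fun j => (e j).2.toNat) 1, omegaKnEnd (fun i => e.symm (i, 0)) 1,
    fun s i => (.ofAdd (φ s i : ℤ), σ s i), ?_, fun s => ?_⟩
  · refine continuous_pi fun i => continuous_discrete_rng.2 fun c => ?_
    refine isOpen_iff_mem_nhds.2 fun s hs => ?_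
    have hev : ∀ a, ∀ᶠ t : graphEnd (omegaKn n) in 𝓝 s, t.1 (i, a) = s.1 (i, a) := fun a => by
      have ha : Continuous fun t : graphEnd (omegaKn n) => t.1 (i, a) :=
        (continuous_apply (i, a)).comp continuous_subtype_val
      exact ((isOpen_discrete {s.1 (i, a)}).preimage ha).mem_nhds rfl
    filter_upwards [eventually_all.2 hev] with t ht
    have ht' : ∀ a, (φ t i, σ t i a) = (φ s i, σ s i a) := fun a => by
      have := ht a
      rwa [hφσ t, hφσ s] at this
    rw [Set.mem_preimage, Set.mem_singleton_iff] at hs ⊢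
    rw [← hs]
    refine Prod.ext ?_ (Equiv.ext fun a => (Prod.ext_iff.1 (ht' a)).2)
    have := (Prod.ext_iff.1 (ht' ⟨0, hn⟩)).1
    simp only at this
    simp only [this]
  · conv_lhs => rw [hφσ s]
    funext u
    simp [shiftEnd]

/-- A second countable topology on `End(ωKₙ)` with continuous translations and with the same Borel
sets as the pointwise topology is coarser than the pointwise topology. -/
theorem pointwiseTop_le_of_borel_eq {n : ℕ} (hn : 1 ≤ n)
    (τ : TopologicalSpace (graphEnd (omegaKn n))) (hsc : @SecondCountableTopology _ τ)
    (hborel : @borel _ τ = @borel _ (pointwiseTop (ℕ × Fin n) (graphEnd (omegaKn n))))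
    (hτ : ∀ g k : graphEnd (omegaKn n), Continuous[τ, τ] fun f =>
      (⟨g.1 ∘ f.1 ∘ k.1, graphEnd_comp _ _ (graphEnd_comp _ _ k.2 _ f.2) _ g.2⟩ :
        graphEnd (omegaKn n))) :
    pointwiseTop (ℕ × Fin n) (graphEnd (omegaKn n)) ≤ τ := by
  let : TopologicalSpace (Equiv.Perm (Fin n)) := ⊥
  have : DiscreteTopology (Equiv.Perm (Fin n)) := ⟨rfl⟩
  rw [pointwiseTop_eq_subtype] at hborel ⊢
  let e : ℕ ≃ ℕ × ℤ := (Denumerable.eqv (ℕ × ℤ)).symm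
  have hcont : Continuous[_, τ] (shiftEnd (n := n) e) := by
    refine continuous_of_borel_of_leftTranslation (fun U hU => ?_)
      fun γ => ⟨_, hτ (shiftEnd e γ) (omegaKnEnd id 1), fun δ => ?_⟩
    · have hU' : MeasurableSet[@borel _ τ] U := MeasurableSpace.measurableSet_generateFrom hU
      rw [hborel] at hU'
      exact @Continuous.borel_measurable _ _ _ instTopologicalSpaceSubtype _
        (continuous_shiftEnd e) _ hU'
    · rw [shiftEnd_mul]
      rfl
  obtain ⟨f₀, g₀, γ, hγ, hfact⟩ := exists_continuous_shiftEnd_factorization hn e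
  rw [← continuous_id_iff_le]
  have hcomp := @Continuous.comp _ _ _ instTopologicalSpaceSubtype τ τ _ _ (hτ f₀ g₀)
    (@Continuous.comp _ _ _ instTopologicalSpaceSubtype _ τ _ _ hcont hγ)
  have hid : id = (fun f : graphEnd (omegaKn n) =>
      (⟨f₀.1 ∘ f.1 ∘ g₀.1, graphEnd_comp _ _ (graphEnd_comp _ _ g₀.2 _ f.2) _ f₀.2⟩ :
        graphEnd (omegaKn n))) ∘ shiftEnd e ∘ γ :=
    funext fun s => Subtype.ext (hfact s)
  rw [hid]
  exact hcomp

theorem omegaKn_unique_polish_semigroup_topology (n : ℕ) (hn : 1 ≤ n) :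
    IsPolishSemigroupTop (graphEnd_comp (omegaKn n))
        (pointwiseTop (ℕ × Fin n) (graphEnd (omegaKn n))) ∧
      ∀ τ : TopologicalSpace ↥(graphEnd (omegaKn n)),
        IsPolishSemigroupTop (graphEnd_comp (omegaKn n)) τ →
        τ = pointwiseTop (ℕ × Fin n) (graphEnd (omegaKn n)) := by
  refine ⟨isPolishSemigroupTop_pointwiseTop _, fun τ hτ => ?_⟩
  obtain ⟨hpol, hmul⟩ := hτ
  have htrans : ∀ g k : graphEnd (omegaKn n), Continuous[τ, τ] fun f =>
      (⟨g.1 ∘ f.1 ∘ k.1, graphEnd_comp _ _ (graphEnd_comp _ _ k.2 _ f.2) _ g.2⟩ :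
        graphEnd (omegaKn n)) := fun g k => by
    let := τ
    have h₁ := hmul.comp ((continuous_const (y := k)).prodMk continuous_id)
    exact hmul.comp (h₁.prodMk (continuous_const (y := g)))
  have hle := le_pointwiseTop_of_t1 hn τ (by let := τ; infer_instance) htrans
  refine le_antisymm hle (pointwiseTop_le_of_borel_eq hn τ (by let := τ; infer_instance) ?_ htrans)
  exact borel_eq_borel_of_le hpol (isPolishSemigroupTop_pointwiseTop _).1 hle
end

section
/- Let E be an equivalence relation on a countably infinite set X each of whose equivalence classes is infinite, and let End(X, E) be the monoid of all maps f : X → X such that (f(x), f(y)) ∈ E whenever (x, y) ∈ E, under composition. Then the pointwise topology on End(X, E) is a Polish semigroup topology, and it is the unique Polish semigroup topology on End(X, E). -/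
variable {X : Type*}

/-- The endomorphism monoid of the structure `(X, E)`: all maps preserving the
binary relation `E`. -/
def relEnd (E : X → X → Prop) : Set (X → X) :=
  {f : X → X | ∀ x y : X, E x y → E (f x) (f y)}

theorem relEnd_comp (E : X → X → Prop) :
    ∀ f ∈ relEnd E, ∀ g ∈ relEnd E, g ∘ f ∈ relEnd E :=
  fun _ hf _ hg x y h => hg _ _ (hf x y h)

open Set Filter Topology

/-- A Borel map from a Polish group is continuous as soon as each right translation of the group
can be undone by a continuous self-map of the codomain. -/
theorem continuous_of_measurable_of_translate {G S : Type*} [AddGroup G] [TopologicalSpace G]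
    [PolishSpace G] [ContinuousAdd G] [TopologicalSpace S] [SecondCountableTopology S]
    (φ : G → S) (hφ : @Measurable G S (borel G) (borel S) φ)
    (htrans : ∀ h, ∃ R : S → S, Continuous R ∧ ∀ g, R (φ (g + h)) = φ g) :
    Continuous φ := by
  let : MeasurableSpace G := borel G
  have : BorelSpace G := ⟨rfl⟩
  let : MeasurableSpace S := borel S
  have : BorelSpace S := ⟨rfl⟩
  have hbasis := TopologicalSpace.isBasis_countableBasis S
  have hcount := TopologicalSpace.countable_countableBasis S
  have hopen : ∀ U ∈ TopologicalSpace.countableBasis S,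
      ∃ O : Set G, IsOpen O ∧ φ ⁻¹' U =ᶠ[residual G] O := fun U hU =>
    (hφ (hbasis.isOpen hU).measurableSet).residualEq_isOpen
  choose! O hO hOeq using hopen
  obtain ⟨D, hD, hDO⟩ : ∃ D ∈ residual G,
      ∀ x ∈ D, ∀ U ∈ TopologicalSpace.countableBasis S, φ x ∈ U ↔ x ∈ O U := by
    refine ⟨_, (eventually_countable_ball hcount).2 fun U hU => (hOeq U hU).mem_iff,
      fun x hx => hx⟩
  rw [continuous_iff_seqContinuous]
  intro g a hg
  have htr : ∀ b : G, ∀ᶠ h in residual G, b + h ∈ D := fun b =>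
    tendsto_residual_of_isOpenMap (Homeomorph.addLeft b).continuous
      (Homeomorph.addLeft b).isOpenMap hD
  have hres : ∀ᶠ h in residual G, a + h ∈ D ∧ ∀ n, g n + h ∈ D :=
    (htr a).and (eventually_countable_forall.2 fun n => htr (g n))
  obtain ⟨h, hah, hgh⟩ := (dense_of_mem_residual hres).nonempty
  obtain ⟨R, hR, hRφ⟩ := htrans h
  have hlim : Tendsto (fun n => φ (g n + h)) atTop (𝓝 (φ (a + h))) := by
    rw [(hbasis.nhds_hasBasis).tendsto_right_iff]
    rintro U ⟨hU, haU⟩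
    have hmem := (hDO _ hah U hU).1 haU
    have : Tendsto (fun n => g n + h) atTop (𝓝 (a + h)) := hg.add_const h
    filter_upwards [this.eventually ((hO U hU).mem_nhds hmem)] with n hn
    exact (hDO _ (hgh n) U hU).2 hn
  have := (hR.tendsto _).comp hlim
  simpa only [Function.comp_def, hRφ] using this

theorem pointwiseTop_eq_induced (S : Set (X → X)) :
    pointwiseTop X S =
      TopologicalSpace.induced Subtype.val (@Pi.topologicalSpace X (fun _ => X) fun _ => ⊥) := by
  let : TopologicalSpace X := ⊥
  have : DiscreteTopology X := ⟨rfl⟩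
  apply le_antisymm
  · rw [← continuous_iff_le_induced]
    let := pointwiseTop X S
    refine continuous_pi fun x => continuous_discrete_rng.2 fun y => ?_
    exact TopologicalSpace.isOpen_generateFrom_of_mem ⟨x, y, rfl⟩
  · refine le_generateFrom ?_
    rintro _ ⟨x, y, rfl⟩
    exact ((isOpen_discrete {y}).preimage (continuous_apply (A := fun _ : X => X) x)).preimage
      continuous_subtype_val

theorem continuous_comp_eval {S : Set (X → X)} {Z : Type*} [TopologicalSpace Z] (x : X)
    (k : X → Z) : Continuous[pointwiseTop X S, _] fun f : S => k (f.1 x) := by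
  let : TopologicalSpace X := ⊥
  have : DiscreteTopology X := ⟨rfl⟩
  let := pointwiseTop X S
  have : Continuous fun f : S => f.1 x := continuous_discrete_rng.2 fun y =>
    TopologicalSpace.isOpen_generateFrom_of_mem ⟨x, y, rfl⟩
  exact (continuous_of_discreteTopology (f := k)).comp this

theorem isPolishSemigroupTop_pointwiseTop_s5 [Countable X] (E : X → X → Prop) :
    IsPolishSemigroupTop (relEnd_comp E) (pointwiseTop X (relEnd E)) := by
  constructor
  · rw [pointwiseTop_eq_induced]
    let : TopologicalSpace X := ⊥
    have : DiscreteTopology X := ⟨rfl⟩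
    have hclosed : IsClosed (relEnd E) := by
      simp only [relEnd, ofPred_forall]
      refine isClosed_iInter fun x => isClosed_iInter fun y => isClosed_iInter fun _ => ?_
      exact (isClosed_discrete {p : X × X | E p.1 p.2}).preimage
        ((continuous_apply (A := fun _ : X => X) x).prodMk (continuous_apply y))
    have : SecondCountableTopology X :=
      DiscreteTopology.secondCountableTopology_of_countable
    exact hclosed.polishSpace
  · let := pointwiseTop X (relEnd E)
    refine continuous_generateFrom_iff.2 ?_
    rintro _ ⟨x, y, rfl⟩
    have hop : ∀ x y : X, IsOpen {f : relEnd E | f.1 x = y} := fun x y =>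
      TopologicalSpace.isOpen_generateFrom_of_mem ⟨x, y, rfl⟩
    have : ((fun p : relEnd E × relEnd E =>
        (⟨p.2.1 ∘ p.1.1, relEnd_comp E _ p.1.2 _ p.2.2⟩ : relEnd E)) ⁻¹' {f | f.1 x = y}) =
        ⋃ z, {f : relEnd E | f.1 x = z} ×ˢ {f : relEnd E | f.1 z = y} := by
      ext p
      simp
    exact this ▸ isOpen_iUnion fun z => (hop x z).prod (hop z y)

theorem IsPolishSemigroupTop.continuous_comp {S : Set (X → X)}
    {hS : ∀ f ∈ S, ∀ g ∈ S, g ∘ f ∈ S} {τ : TopologicalSpace ↥S} (hτ : IsPolishSemigroupTop hS τ)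
    {Z : Type*} {_ : TopologicalSpace Z} {f g : Z → S} (hf : Continuous[_, τ] f)
    (hg : Continuous[_, τ] g) :
    Continuous[_, τ] fun z => (⟨(g z).1 ∘ (f z).1, hS _ (f z).2 _ (g z).2⟩ : S) :=
  hτ.2.comp (hf.prodMk hg)

/-- Every Polish semigroup topology on `relEnd E` refines the pointwise topology: the constant maps
form a countable closed set, which is discrete by the Baire category theorem. -/
theorem IsPolishSemigroupTop.le_pointwiseTop [Countable X] {E : X → X → Prop}
    (hE : Equivalence E) (hclasses : ∀ x : X, {y : X | E x y}.Infinite)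
    {τ : TopologicalSpace ↥(relEnd E)} (hτ : IsPolishSemigroupTop (relEnd_comp E) τ) :
    τ ≤ pointwiseTop X (relEnd E) := by
  have hP := hτ.1
  have hright : ∀ f : relEnd E, Continuous fun g : relEnd E =>
      (⟨g.1 ∘ f.1, relEnd_comp E _ f.2 _ g.2⟩ : relEnd E) := fun f =>
    hτ.continuous_comp continuous_const continuous_id
  have hleft : ∀ g : relEnd E, Continuous fun f : relEnd E =>
      (⟨g.1 ∘ f.1, relEnd_comp E _ f.2 _ g.2⟩ : relEnd E) := fun g =>
    hτ.continuous_comp continuous_id continuous_const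
  let c : X → relEnd E := fun x => ⟨fun _ => x, fun _ _ _ => hE.refl x⟩
  rcases isEmpty_or_nonempty X with hX | hX
  · refine le_generateFrom ?_
    rintro _ ⟨x, -, -⟩
    exact hX.elim x
  have hclosed : IsClosed (range c) := by
    have : range c = ⋂ f : relEnd E,
        {g | (⟨g.1 ∘ f.1, relEnd_comp E _ f.2 _ g.2⟩ : relEnd E) = g} := by
      ext g
      simp only [mem_range, mem_iInter, mem_ofPred_eq]
      constructor
      · rintro ⟨x, rfl⟩ f
        rfl
      · intro h
        obtain ⟨x⟩ := hX
        refine ⟨g.1 x, ?_⟩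
        rw [← h (c x)]
        rfl
    rw [this]
    exact isClosed_iInter fun f => isClosed_eq (hright f) continuous_id
  have : PolishSpace (range c) := hclosed.polishSpace
  obtain ⟨p, hp⟩ : ∃ p, IsOpen ({⟨c p, mem_range_self p⟩} : Set (range c)) := by
    obtain ⟨p, q, hq⟩ := nonempty_interior_of_iUnion_of_closed
      (f := fun p : X => ({⟨c p, mem_range_self p⟩} : Set (range c)))
      (fun p => isClosed_singleton) (by
        ext ⟨_, x, rfl⟩
        simp only [mem_iUnion, mem_univ, iff_true]
        exact ⟨x, rfl⟩)
    refine ⟨p, ?_⟩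
    have hsub := interior_subset hq
    have hqp : q = ⟨c p, mem_range_self p⟩ := hsub
    refine interior_eq_iff_isOpen.1 (Subset.antisymm interior_subset ?_)
    exact singleton_subset_iff.2 (hqp ▸ hq)
  obtain ⟨O, hO, hOp⟩ := isOpen_induced_iff.1 hp
  have hmemO : ∀ x, c x ∈ O ↔ x = p := by
    intro x
    have : (⟨c x, mem_range_self x⟩ : range c) ∈ Subtype.val ⁻¹' O ↔
        (⟨c x, mem_range_self x⟩ : range c) ∈
        ({⟨c p, mem_range_self p⟩} : Set (range c)) := by
      rw [hOp]
    simp only [mem_preimage, mem_singleton_iff, Subtype.mk.injEq] at this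
    rw [this]
    constructor
    · intro h
      exact congrFun (congrArg Subtype.val h) x
    · rintro rfl
      rfl
  obtain ⟨p', hpp', hne⟩ : ∃ p', E p p' ∧ p' ≠ p := by
    obtain ⟨p', h, h'⟩ := (hclasses p).exists_notMem_finite (finite_singleton p)
    exact ⟨p', h, h'⟩
  refine le_generateFrom ?_
  rintro _ ⟨x, y, rfl⟩
  classical
  let r : relEnd E := ⟨fun z => if z = y then p else p', fun a b _ => by
    dsimp only
    split_ifs
    exacts [hE.refl p, hpp', hE.symm hpp', hE.refl p']⟩
  have : {f : relEnd E | f.1 x = y} =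
      (fun f : relEnd E => (⟨r.1 ∘ (f.1 ∘ (c x).1), relEnd_comp E _
        (relEnd_comp E _ (c x).2 _ f.2) _ r.2⟩ : relEnd E)) ⁻¹' O := by
    ext f
    have h1 : (⟨r.1 ∘ (f.1 ∘ (c x).1), relEnd_comp E _
        (relEnd_comp E _ (c x).2 _ f.2) _ r.2⟩ : relEnd E) = c (r.1 (f.1 x)) := rfl
    rw [mem_preimage, h1, hmemO]
    by_cases h : f.1 x = y <;> simp [r, h, hne]
  rw [this]
  exact hO.preimage ((hleft r).comp (hright (c x)))

/-- A homomorphism from the group `Y → ℤ` to `relEnd E` which is continuous for the pointwise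
topology is continuous for every Polish semigroup topology finer than it. -/
theorem IsPolishSemigroupTop.continuous_of_add [Countable X] {E : X → X → Prop}
    {τ : TopologicalSpace ↥(relEnd E)} (hτ : IsPolishSemigroupTop (relEnd_comp E) τ)
    (hle : τ ≤ pointwiseTop X (relEnd E)) {Y : Type*} [Countable Y]
    (φ : (Y → ℤ) → relEnd E) (hadd : ∀ u v, (φ (u + v)).1 = (φ u).1 ∘ (φ v).1)
    (hopen : ∀ x y, IsOpen {u | (φ u).1 x = y}) :
    Continuous[_, τ] φ := by
  have hborel : @borel _ τ = @borel _ (pointwiseTop X (relEnd E)) :=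
    MeasureTheory.borel_eq_borel_of_le hτ.1 (isPolishSemigroupTop_pointwiseTop_s5 E).1 hle
  have hP := hτ.1
  refine continuous_of_measurable_of_translate φ ?_ fun h => ?_
  · rw [hborel]
    have hcont : Continuous[_, pointwiseTop X (relEnd E)] φ := by
      refine continuous_generateFrom_iff.2 ?_
      rintro _ ⟨x, y, rfl⟩
      exact hopen x y
    exact @Continuous.borel_measurable _ _ _ (pointwiseTop X (relEnd E)) _ hcont
  · refine ⟨fun g => ⟨g.1 ∘ (φ (-h)).1, relEnd_comp E _ (φ (-h)).2 _ g.2⟩,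
      hτ.continuous_comp continuous_const continuous_id, fun g => Subtype.ext ?_⟩
    change (φ (g + h)).1 ∘ (φ (-h)).1 = _
    rw [← hadd, add_neg_cancel_right]

/-- `e` identifies the classes of `E` with the fibres of the first projection. -/
def IsFibering {κ Y : Type*} (E : X → X → Prop) (e : X ≃ κ × Y) : Prop :=
  ∀ x y, E x y ↔ (e x).1 = (e y).1

theorem exists_isFibering [Countable X] (E : X → X → Prop) (hE : Equivalence E)
    (hclasses : ∀ x : X, {y : X | E x y}.Infinite) :
    ∃ e : X ≃ Quotient (⟨E, hE⟩ : Setoid X) × ℤ, IsFibering E e := by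
  let s : Setoid X := ⟨E, hE⟩
  have hfib : ∀ q : Quotient s, Nonempty ({x // Quotient.mk s x = q} ≃ ℤ) := by
    intro q
    obtain ⟨x, rfl⟩ := Quotient.exists_rep q
    have : Infinite {y // Quotient.mk s y = Quotient.mk s x} := by
      have h := (hclasses x).to_subtype
      refine Infinite.of_injective
        (fun y : {y : X | E x y} => ⟨y.1, Quotient.sound (hE.symm y.2)⟩) ?_
      intro a b hab
      exact Subtype.ext (congrArg (fun z => z.1) hab)
    exact nonempty_equiv_of_countable
  have w := fun q => (hfib q).some
  refine ⟨(Equiv.sigmaFiberEquiv (Quotient.mk s)).symm.trans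
    ((Equiv.sigmaCongrRight w).trans (Equiv.sigmaEquivProd _ _)), fun x y => ?_⟩
  exact (Quotient.eq (r := s)).symm

/-- The endomorphism given in coordinates by a map sending fibres into fibres. -/
def relEndOfFibering {κ Y κ' Y' : Type*} {E : X → X → Prop} {e : X ≃ κ × Y} {e' : X ≃ κ' × Y'}
    (he : IsFibering E e) (he' : IsFibering E e') (F : κ × Y → κ' × Y')
    (hF : ∀ p q, p.1 = q.1 → (F p).1 = (F q).1) : relEnd E :=
  ⟨fun x => e'.symm (F (e x)), fun x y h => (he' _ _).2 <| by
    simpa using hF _ _ ((he x y).1 h)⟩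

section Shear

variable {E : X → X → Prop} {κ : Type*} {e : X ≃ κ × ℤ}

/-- The endomorphism fixing every class and acting on the second coordinate by `u`. -/
def fibreMap (he : IsFibering E e) (u : κ × ℤ → ℤ) : relEnd E :=
  relEndOfFibering he he (fun p => (p.1, u p)) fun _ _ h => h

/-- The endomorphism acting on the classes by `t` and preserving the second coordinate. -/
def baseMap (he : IsFibering E e) (t : κ → κ) : relEnd E :=
  relEndOfFibering he he (fun p => (t p.1, p.2)) fun _ _ h => congrArg t h

theorem continuous_fibreMap [Countable X] (he : IsFibering E e)
    {τ : TopologicalSpace ↥(relEnd E)} (hτ : IsPolishSemigroupTop (relEnd_comp E) τ)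
    (hle : τ ≤ pointwiseTop X (relEnd E)) :
    Continuous[_, τ] (fibreMap he) := by
  have : Countable (κ × ℤ) := e.symm.injective.countable
  obtain ⟨w⟩ : Nonempty (ℤ ≃ ℤ × ℤ) := nonempty_equiv_of_countable
  let e₁ : X ≃ κ × (ℤ × ℤ) := e.trans ((Equiv.refl κ).prodCongr w)
  have he₁ : IsFibering E e₁ := he
  let φ : (κ × ℤ → ℤ) → relEnd E := fun u =>
    relEndOfFibering he₁ he₁ (fun p => (p.1, p.2.1, u (p.1, p.2.1) + p.2.2)) fun _ _ h => h
  have hφ : Continuous[_, τ] φ := by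
    refine hτ.continuous_of_add hle φ (fun u v => ?_) fun x y => ?_
    · ext x
      simp [φ, relEndOfFibering, add_assoc]
    · exact (isOpen_discrete {n : ℤ | e₁.symm ((e₁ x).1, (e₁ x).2.1, n + (e₁ x).2.2) = y}).preimage
        (continuous_apply (A := fun _ => ℤ) ((e₁ x).1, (e₁ x).2.1))
  let f : relEnd E := relEndOfFibering he₁ he (fun p => (p.1, p.2.2)) fun _ _ h => h
  let g : relEnd E := relEndOfFibering he he₁ (fun p => (p.1, p.2, 0)) fun _ _ h => h
  have hcomp := hτ.continuous_comp (continuous_const (y := g))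
    (hτ.continuous_comp hφ (continuous_const (y := f)))
  convert hcomp using 1
  funext u
  ext x
  simp [φ, f, g, fibreMap, relEndOfFibering]

theorem continuous_baseMap [TopologicalSpace κ] [DiscreteTopology κ] [Countable X]
    (he : IsFibering E e)
    {τ : TopologicalSpace ↥(relEnd E)} (hτ : IsPolishSemigroupTop (relEnd_comp E) τ)
    (hle : τ ≤ pointwiseTop X (relEnd E)) :
    Continuous[_, τ] (baseMap he) := by
  have hκ : Countable κ := by
    have : Function.Injective fun c : κ => e.symm (c, 0) := fun a b h => by simpa using h
    exact this.countable
  rcases finite_or_infinite κ with hfin | hinf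
  · exact continuous_of_discreteTopology
  obtain ⟨w⟩ : Nonempty (κ ≃ κ × κ) := nonempty_equiv_of_countable
  obtain ⟨z⟩ : Nonempty (κ ≃ ℤ) := nonempty_equiv_of_countable
  let e₂ : X ≃ (κ × κ) × ℤ := e.trans (w.prodCongr (Equiv.refl ℤ))
  have he₂ : IsFibering E e₂ := fun x y => by simp [he x y, e₂]
  let φ : (κ → ℤ) → relEnd E := fun u =>
    relEndOfFibering he₂ he₂ (fun p => ((p.1.1, z.symm (u p.1.1 + z p.1.2)), p.2))
      fun _ _ h => by simp [h]
  have hφ : Continuous[_, τ] φ := by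
    refine hτ.continuous_of_add hle φ (fun u v => ?_) fun x y => ?_
    · ext x
      simp [φ, relEndOfFibering, add_assoc]
    · exact (isOpen_discrete {n : ℤ | e₂.symm (((e₂ x).1.1, z.symm (n + z (e₂ x).1.2)), (e₂ x).2)
        = y}).preimage (continuous_apply (A := fun _ => ℤ) (e₂ x).1.1)
  let f : relEnd E := relEndOfFibering he₂ he (fun p => (p.1.2, p.2)) fun _ _ h => by simp [h]
  let g : relEnd E := relEndOfFibering he he₂ (fun p => ((p.1, z.symm 0), p.2))
    fun _ _ h => by simp [h]
  have hz : Continuous fun (t : κ → κ) (c : κ) => z (t c) :=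
    continuous_pi fun c => continuous_of_discreteTopology.comp (continuous_apply c)
  have hcomp := hτ.continuous_comp (continuous_const (y := g))
    (hτ.continuous_comp (hφ.comp hz) (continuous_const (y := f)))
  convert hcomp using 1
  funext u
  ext x
  simp [φ, f, g, baseMap, relEndOfFibering]

theorem pointwiseTop_le_of_isFibering [Countable X] (he : IsFibering E e)
    {τ : TopologicalSpace ↥(relEnd E)} (hτ : IsPolishSemigroupTop (relEnd_comp E) τ)
    (hle : τ ≤ pointwiseTop X (relEnd E)) :
    pointwiseTop X (relEnd E) ≤ τ := by
  let : TopologicalSpace κ := ⊥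
  have : DiscreteTopology κ := ⟨rfl⟩
  have hbase : Continuous[pointwiseTop X (relEnd E), _]
      fun (f : relEnd E) (c : κ) => (e (f.1 (e.symm (c, 0)))).1 :=
    @continuous_pi _ _ _ (pointwiseTop X (relEnd E)) _ _ fun c =>
      continuous_comp_eval _ fun x => (e x).1
  have hfibre : Continuous[pointwiseTop X (relEnd E), _]
      fun (f : relEnd E) (p : κ × ℤ) => (e (f.1 (e.symm p))).2 :=
    @continuous_pi _ _ _ (pointwiseTop X (relEnd E)) _ _ fun p =>
      continuous_comp_eval _ fun x => (e x).2
  have hcomp := hτ.continuous_comp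
    (@Continuous.comp _ _ _ (pointwiseTop X (relEnd E)) _ τ _ _
      (continuous_fibreMap he hτ hle) hfibre)
    (@Continuous.comp _ _ _ (pointwiseTop X (relEnd E)) _ τ _ _
      (continuous_baseMap he hτ hle) hbase)
  rw [← continuous_id_iff_le]
  convert hcomp using 1
  funext f
  refine Subtype.ext (funext fun x => e.injective (Prod.ext ?_ ?_))
  · simpa [fibreMap, baseMap, relEndOfFibering] using
      (he _ _).1 (f.2 x (e.symm ((e x).1, 0)) ((he _ _).2 (by simp)))
  · simp [fibreMap, baseMap, relEndOfFibering]

end Shear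

theorem equivalenceRelation_unique_polish_semigroup_topology
    [Countable X] [Infinite X] (E : X → X → Prop)
    (hE : Equivalence E)
    (hclasses : ∀ x : X, {y : X | E x y}.Infinite) :
    IsPolishSemigroupTop (relEnd_comp E) (pointwiseTop X (relEnd E)) ∧
      ∀ τ : TopologicalSpace ↥(relEnd E),
        IsPolishSemigroupTop (relEnd_comp E) τ →
        τ = pointwiseTop X (relEnd E) := by
  refine ⟨isPolishSemigroupTop_pointwiseTop_s5 E, fun τ hτ => ?_⟩
  have hle := hτ.le_pointwiseTop hE hclasses
  obtain ⟨e, he⟩ := exists_isFibering E hE hclasses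
  exact le_antisymm hle (pointwiseTop_le_of_isFibering he hτ hle)
end

section
/- Let End(ℚ, ≤) be the monoid of all monotone (order-preserving) maps f : ℚ → ℚ under composition. Then every T1 topology on End(ℚ, ≤) which is semitopological contains the pointwise topology; equivalently, in every such topology all the sets {f ∈ End(ℚ, ≤) : f(x) = y} for x, y ∈ ℚ are open. -/
/-- The endomorphism monoid of `(ℚ, ≤)`: all monotone maps `ℚ → ℚ`. -/
def monotoneEnd : Set (ℚ → ℚ) := {f : ℚ → ℚ | Monotone f}

theorem monotoneEnd_comp :
    ∀ f ∈ monotoneEnd, ∀ g ∈ monotoneEnd, g ∘ f ∈ monotoneEnd :=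
  fun _ hf _ hg => hg.comp hf

/-- In a T1 semitopological topology on `End(ℚ, ≤)`, the set of maps `f` with `a (f x) = z` is
closed: it is the preimage of a constant map under `f ↦ a ∘ f ∘ const x`. -/
theorem isClosed_setOf_comp_apply_eq
    (τ : TopologicalSpace ↥monotoneEnd)
    (hT1 : @T1Space ↥monotoneEnd τ)
    (hsemitop : ∀ g : ↥monotoneEnd,
      (@Continuous ↥monotoneEnd ↥monotoneEnd τ τ
        (fun f => ⟨f.1 ∘ g.1, monotoneEnd_comp g.1 g.2 f.1 f.2⟩)) ∧
      (@Continuous ↥monotoneEnd ↥monotoneEnd τ τ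
        (fun f => ⟨g.1 ∘ f.1, monotoneEnd_comp f.1 f.2 g.1 g.2⟩)))
    {a : ℚ → ℚ} (ha : Monotone a) (x z : ℚ) :
    IsClosed {f : ↥monotoneEnd | a (f.1 x) = z} := by
  have hconst (c : ℚ) : (fun _ => c) ∈ monotoneEnd := monotone_const
  have hcont := (hsemitop ⟨a, ha⟩).2.comp (hsemitop ⟨_, hconst x⟩).1
  convert (isClosed_singleton (x := (⟨_, hconst z⟩ : ↥monotoneEnd))).preimage hcont using 1
  ext f
  simp [Subtype.ext_iff, funext_iff]

theorem rationalsEnd_T1_semitopological_contains_pointwise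
    (τ : TopologicalSpace ↥monotoneEnd)
    (hT1 : @T1Space ↥monotoneEnd τ)
    (hsemitop : ∀ g : ↥monotoneEnd,
      (@Continuous ↥monotoneEnd ↥monotoneEnd τ τ
        (fun f => ⟨f.1 ∘ g.1, monotoneEnd_comp g.1 g.2 f.1 f.2⟩)) ∧
      (@Continuous ↥monotoneEnd ↥monotoneEnd τ τ
        (fun f => ⟨g.1 ∘ f.1, monotoneEnd_comp f.1 f.2 g.1 g.2⟩))) :
    ∀ U : Set ↥monotoneEnd,
      @IsOpen ↥monotoneEnd (pointwiseTop ℚ monotoneEnd) U →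
      @IsOpen ↥monotoneEnd τ U := by
  refine fun U hU => (le_generateFrom (t := τ) ?_ : τ ≤ pointwiseTop ℚ monotoneEnd) U hU
  rintro _ ⟨x, y, rfl⟩
  have hgt : Monotone fun q : ℚ => if y < q then (1 : ℚ) else 0 := by
    intro p q hpq
    dsimp only
    split_ifs <;> linarith
  have hge : Monotone fun q : ℚ => if y ≤ q then (1 : ℚ) else 0 := by
    intro p q hpq
    dsimp only
    split_ifs <;> linarith
  rw [← isClosed_compl_iff]
  convert (isClosed_setOf_comp_apply_eq τ hT1 hsemitop hgt x 1).union
    (isClosed_setOf_comp_apply_eq τ hT1 hsemitop hge x 0) using 1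
  ext f
  simp [or_comm, ← lt_or_lt_iff_ne]
end

section
/- Let 𝔸 be a countable ω-categorical relational structure with no algebraicity. Then for every a ∈ A there exist self-embeddings α, β of 𝔸 such that α(x) = β(x) if and only if x ≠ a. -/
open Set

variable {A : Type*} {ι : Type*}

/-- `f` is a homomorphism (endomorphism) of the relational structure `(A, rel)`. -/
def IsHom (ar : ι → ℕ) (rel : ∀ i, (Fin (ar i) → A) → Prop) (f : A → A) : Prop :=
  ∀ (i : ι) (x : Fin (ar i) → A), rel i x → rel i (f ∘ x)

/-- `f` is a self-embedding of the relational structure `(A, rel)`. -/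
def IsEmb (ar : ι → ℕ) (rel : ∀ i, (Fin (ar i) → A) → Prop) (f : A → A) : Prop :=
  Function.Injective f ∧ ∀ (i : ι) (x : Fin (ar i) → A), (rel i x ↔ rel i (f ∘ x))

/-- `f` is an automorphism of the relational structure `(A, rel)`. -/
def IsAuto (ar : ι → ℕ) (rel : ∀ i, (Fin (ar i) → A) → Prop) (f : A → A) : Prop :=
  Function.Bijective f ∧ ∀ (i : ι) (x : Fin (ar i) → A), (rel i x ↔ rel i (f ∘ x))

/-- `p` is an isomorphism between induced substructures when restricted to `D`. -/
def IsPartialIsoOn (ar : ι → ℕ) (rel : ∀ i, (Fin (ar i) → A) → Prop)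
    (D : Set A) (p : A → A) : Prop :=
  Set.InjOn p D ∧
    ∀ (i : ι) (x : Fin (ar i) → A), (∀ k, x k ∈ D) → (rel i x ↔ rel i (p ∘ x))

/-- `p` is a homomorphism between induced substructures when restricted to `D`. -/
def IsPartialHomOn (ar : ι → ℕ) (rel : ∀ i, (Fin (ar i) → A) → Prop)
    (D : Set A) (p : A → A) : Prop :=
  ∀ (i : ι) (x : Fin (ar i) → A), (∀ k, x k ∈ D) → rel i x → rel i (p ∘ x)

/-- Every isomorphism between finite induced substructures extends to an automorphism. -/
def Homogeneous (ar : ι → ℕ) (rel : ∀ i, (Fin (ar i) → A) → Prop) : Prop :=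
  ∀ (D : Finset A) (p : A → A), IsPartialIsoOn ar rel ↑D p →
    ∃ g : A → A, IsAuto ar rel g ∧ ∀ a ∈ D, g a = p a

/-- Every orbit on `A \ F` of the pointwise stabiliser of a finite set `F` is infinite. -/
def NoAlgebraicity (ar : ι → ℕ) (rel : ∀ i, (Fin (ar i) → A) → Prop) : Prop :=
  ∀ (F : Finset A) (a : A), a ∉ F →
    {b : A | ∃ g : A → A, IsAuto ar rel g ∧ (∀ x ∈ F, g x = x) ∧ g a = b}.Infinite

/-- For every `k`, the action of the automorphism group on `k`-tuples has
finitely many orbits. -/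
def OmegaCategorical (ar : ι → ℕ) (rel : ∀ i, (Fin (ar i) → A) → Prop) : Prop :=
  ∀ k : ℕ,
    (Set.range fun v : Fin k → A =>
      {w : Fin k → A | ∃ g : A → A, IsAuto ar rel g ∧ w = g ∘ v}).Finite

/-- The endomorphisms of `(A, rel)`, as a set of functions. -/
def endSet (ar : ι → ℕ) (rel : ∀ i, (Fin (ar i) → A) → Prop) : Set (A → A) :=
  {f : A → A | IsHom ar rel f}

/-- The self-embeddings of `(A, rel)`, as a set of functions. -/
def embSet (ar : ι → ℕ) (rel : ∀ i, (Fin (ar i) → A) → Prop) : Set (A → A) :=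
  {f : A → A | IsEmb ar rel f}

/-- The automorphisms of `(A, rel)`, as a set of functions. -/
def autSet (ar : ι → ℕ) (rel : ∀ i, (Fin (ar i) → A) → Prop) : Set (A → A) :=
  {f : A → A | IsAuto ar rel f}

/-- `(A, rel)` is arsfacere, witnessed by the relation symbol `E`. -/
def ArsfacereWith (ar : ι → ℕ) (rel : ∀ i, (Fin (ar i) → A) → Prop) (E : ι) : Prop :=
  (∀ x : A, ¬ rel E (fun _ => x)) ∧
  ∀ (x : A) (F : Fin (ar E) → Finset A),
    (∀ i j : Fin (ar E), i ≠ j → ((F i : Set A) ∩ (F j : Set A)) = {x}) →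
    ∃ f : A → A,
      Set.InjOn f (⋃ i, (F i : Set A)) ∧
      (∀ i, IsPartialIsoOn ar rel (F i : Set A) f) ∧
      ∀ y : Fin (ar E) → A, (∀ k, y k ∈ F k ∧ y k ≠ x) →
        ∃ σ : Equiv.Perm (Fin (ar E)), rel E (fun k => f (y (σ k)))

open Filter

section AutoLimits

variable {ar : ι → ℕ} {rel : ∀ i, (Fin (ar i) → A) → Prop}

theorem IsAuto.id : IsAuto ar rel (id : A → A) :=
  ⟨Function.bijective_id, fun _ _ => Iff.rfl⟩

theorem IsAuto.comp {f g : A → A} (hf : IsAuto ar rel f) (hg : IsAuto ar rel g) :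
    IsAuto ar rel (f ∘ g) :=
  ⟨hf.1.comp hg.1, fun i x => (hg.2 i x).trans (hf.2 i (g ∘ x))⟩

/-- A pointwise eventual limit of automorphisms is a self-embedding. -/
theorem IsEmb.of_eventually_eq {h : ℕ → A → A} {f : A → A} (hh : ∀ n, IsAuto ar rel (h n))
    (hf : ∀ y, ∀ᶠ n in atTop, h n y = f y) : IsEmb ar rel f := by
  refine ⟨fun y z hyz => ?_, fun i x => ?_⟩
  · obtain ⟨n, hy, hz⟩ := ((hf y).and (hf z)).exists
    exact (hh n).1.1 (by rw [hy, hz, hyz])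
  · obtain ⟨n, hn⟩ := (eventually_all.2 fun k => hf (x k)).exists
    have hx : h n ∘ x = f ∘ x := funext hn
    rw [(hh n).2 i x, hx]

/-- In an ω-categorical structure, along any sequence of points one can choose indices `m n ≥ n`
such that the points at `m n` and `m (n + 1)` have the same type over the first `n` elements
of a given enumeration. -/
theorem OmegaCategorical.exists_coherent_indices (omcat : OmegaCategorical ar rel)
    (x c : ℕ → A) :
    ∃ m : ℕ → ℕ, (∀ n, n ≤ m n) ∧ ∀ n, ∃ k : A → A, IsAuto ar rel k ∧
      (∀ i < n, k (x i) = x i) ∧ k (c (m (n + 1))) = c (m n) := by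
  let v (n l : ℕ) : Fin (n + 1) → A := Fin.cons (c l) fun i : Fin n => x i
  let orb (n : ℕ) (v : Fin (n + 1) → A) : Set (Fin (n + 1) → A) :=
    {w | ∃ g : A → A, IsAuto ar rel g ∧ w = g ∘ v}
  have hlim : ∀ n, ∃ O, ∀ᶠ l in (hyperfilter ℕ : Filter ℕ), orb n (v n l) = O := by
    intro n
    have hfin : (range (orb n)).Finite := omcat (n + 1)
    have hmem : (⋃ O ∈ range (orb n), {l | orb n (v n l) = O}) ∈ hyperfilter ℕ := by
      refine Filter.mem_of_superset univ_mem fun l _ => ?_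
      simp
    obtain ⟨O, -, hO⟩ := (Ultrafilter.finite_biUnion_mem_iff hfin).1 hmem
    exact ⟨O, hO⟩
  choose O hO using hlim
  have hex : ∀ n, ∃ l, n ≤ l ∧ orb n (v n l) = O n ∧ ∀ p, p + 1 = n → orb p (v p l) = O p := by
    intro n
    have hge : ∀ᶠ l in (hyperfilter ℕ : Filter ℕ), n ≤ l :=
      Nat.hyperfilter_le_atTop (eventually_ge_atTop n)
    cases n with
    | zero =>
      obtain ⟨l, h1, h2⟩ := (hge.and (hO 0)).exists
      exact ⟨l, h1, h2, by simp⟩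
    | succ p =>
      obtain ⟨l, h1, h2, h3⟩ := (hge.and ((hO (p + 1)).and (hO p))).exists
      refine ⟨l, h1, h2, fun q hq => ?_⟩
      obtain rfl : q = p := by omega
      exact h3
  choose m hge hcur hprev using hex
  refine ⟨m, hge, fun n => ?_⟩
  have hself : v n (m n) ∈ orb n (v n (m n)) := ⟨id, IsAuto.id, rfl⟩
  rw [hcur n, ← hprev (n + 1) n rfl] at hself
  obtain ⟨k, hk, hv⟩ := hself
  exact ⟨k, hk, fun i hi => (congrFun hv (Fin.succ ⟨i, hi⟩)).symm, (congrFun hv 0).symm⟩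

end AutoLimits

theorem exists_embeddings_differing_exactly_at_point
    [Countable A]
    (ar : ι → ℕ) (rel : ∀ i, (Fin (ar i) → A) → Prop)
    (omcat : OmegaCategorical ar rel)
    (noalg : NoAlgebraicity ar rel) (a : A) :
    ∃ α β : A → A, IsEmb ar rel α ∧ IsEmb ar rel β ∧
      ∀ x : A, (α x = β x ↔ x ≠ a) := by
  classical
  have : Nonempty A := ⟨a⟩
  obtain ⟨x, hx⟩ := exists_surjective_nat A
  have hmove : ∀ n, ∃ g : A → A, IsAuto ar rel g ∧ (∀ i < n, x i ≠ a → g (x i) = x i) ∧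
      g a ≠ a := by
    intro n
    obtain ⟨b, ⟨g, hg, hfix, hb⟩, hba⟩ :=
      (noalg (((Finset.range n).image x).erase a) a (by simp)).exists_notMem_finset {a}
    refine ⟨g, hg, fun i hi hne => hfix _ ?_, by simpa [hb] using hba⟩
    exact Finset.mem_erase.2 ⟨hne, Finset.mem_image_of_mem x (Finset.mem_range.2 hi)⟩
  choose g hg hgfix hga using hmove
  obtain ⟨m, hm, hk⟩ := omcat.exists_coherent_indices x fun l => g l a
  choose k hk hkfix hkc using hk
  let h : ℕ → A → A := fun n => Nat.rec id (fun n f => f ∘ k n) n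
  have hauto : ∀ n, IsAuto ar rel (h n) := by
    intro n
    induction n with
    | zero => exact IsAuto.id
    | succ n ih => exact ih.comp (hk n)
  have hconst : ∀ n, h n (g (m n) a) = g (m 0) a := by
    intro n
    induction n with
    | zero => rfl
    | succ n ih => exact (congrArg (h n) (hkc n)).trans ih
  have hstab : ∀ y, ∃ z, ∀ᶠ n in atTop, h n y = z := by
    intro y
    obtain ⟨i, rfl⟩ := hx y
    refine ⟨h (i + 1) (x i), (eventually_ge_atTop (i + 1)).mono fun n hn => ?_⟩
    induction n, hn using Nat.le_induction with
    | base => rfl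
    | succ n hn ih => exact (congrArg (h n) (hkfix n i hn)).trans ih
  choose α hα using hstab
  refine ⟨α, Function.update α a (g (m 0) a), .of_eventually_eq hauto hα,
    .of_eventually_eq (fun n => (hauto n).comp (hg (m n))) fun y => ?_, fun y => ?_⟩
  · rcases eq_or_ne y a with rfl | hy
    · simp [hconst]
    · obtain ⟨i, rfl⟩ := hx y
      filter_upwards [hα (x i), eventually_gt_atTop i] with n hn hi
      simp [Function.update_of_ne hy, hgfix (m n) i (hi.trans_le (hm n)) hy, hn]
  · rcases eq_or_ne y a with rfl | hy
    · obtain ⟨n, hn⟩ := (hα y).exists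
      simp only [Function.update_self, ne_eq, not_true_eq_false, iff_false]
      rw [← hn, ← hconst n]
      exact fun heq => hga (m n) ((hauto n).1.1 heq).symm
    · simp [hy]
end

section
/- Let M be the monoid of all strictly increasing functions f : ℚ → ℚ under composition (this is the endomorphism monoid End(ℚ, <), which coincides with the self-embedding monoid of (ℚ, <)). Then the Zariski topology on M coincides with the pointwise topology. -/
/-- Evaluation of the word `t₁ · s · t₂ · s ⋯ s · t_k` (with `t₁ = t`,
`[t₂, …, t_k] = ts` and multiplication being composition in diagrammatic
order) at `s`. -/
def polyEval {X : Type*} (t : X → X) (ts : List (X → X)) (s : X → X) : X → X :=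
  ts.foldl (fun acc u => u ∘ s ∘ acc) t

/-- The Zariski topology on a set `S` of self-maps of `X` (a monoid under
composition in diagrammatic order). -/
def zariskiTop (X : Type*) (S : Set (X → X)) : TopologicalSpace ↥S :=
  TopologicalSpace.generateFrom
    {U : Set ↥S | ∃ (t : ↥S) (ts : List ↥S) (u : ↥S) (us : List ↥S),
      U = {s : ↥S | polyEval t.1 (ts.map Subtype.val) s.1
              ≠ polyEval u.1 (us.map Subtype.val) s.1}}

/-- The monoid of strictly increasing maps `ℚ → ℚ`, i.e. the endomorphism
monoid (= self-embedding monoid) of `(ℚ, <)`. -/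
def strictMonoEnd : Set (ℚ → ℚ) := {f : ℚ → ℚ | StrictMono f}

open scoped Topology

theorem isOpen_pointwiseTop_eval {X : Type*} {S : Set (X → X)} (x y : X) :
    IsOpen[pointwiseTop X S] {s : ↥S | s.1 x = y} :=
  TopologicalSpace.isOpen_generateFrom_of_mem ⟨x, y, rfl⟩

theorem isOpen_pointwiseTop_polyEval {X : Type*} {S : Set (X → X)} (t : X → X)
    (ts : List (X → X)) (x y : X) :
    IsOpen[pointwiseTop X S] {s : ↥S | polyEval t ts s.1 x = y} := by
  let _ := pointwiseTop X S
  induction ts using List.reverseRecOn generalizing y with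
  | nil => exact isOpen_const (X := ↥S) (p := t x = y)
  | append_singleton ts u ih =>
    have h : {s : ↥S | polyEval t (ts ++ [u]) s.1 x = y} =
        ⋃ (z : X) (w : X) (_ : u w = y),
          {s : ↥S | polyEval t ts s.1 x = z} ∩ {s : ↥S | s.1 z = w} := by
      ext s
      simp [polyEval]
    rw [h]
    exact isOpen_iUnion fun z => isOpen_iUnion fun w => isOpen_iUnion fun _ =>
      (ih z).inter (isOpen_pointwiseTop_eval z w)

theorem pointwiseTop_le_zariskiTop (X : Type*) (S : Set (X → X)) :
    pointwiseTop X S ≤ zariskiTop X S := by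
  let _ := pointwiseTop X S
  refine le_generateFrom ?_
  rintro _ ⟨t, ts, u, us, rfl⟩
  have h : {s : ↥S | polyEval t.1 (ts.map Subtype.val) s.1
        ≠ polyEval u.1 (us.map Subtype.val) s.1} =
      ⋃ (x : X) (a : X) (b : X) (_ : a ≠ b),
        {s : ↥S | polyEval t.1 (ts.map Subtype.val) s.1 x = a} ∩
          {s : ↥S | polyEval u.1 (us.map Subtype.val) s.1 x = b} := by
    ext s
    simp [Function.ne_iff]
  rw [h]
  exact isOpen_iUnion fun x => isOpen_iUnion fun a => isOpen_iUnion fun b => isOpen_iUnion fun _ =>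
    (isOpen_pointwiseTop_polyEval _ _ x a).inter (isOpen_pointwiseTop_polyEval _ _ x b)

/-- Two strictly increasing self-maps of `ℚ` can differ at exactly one prescribed point. -/
theorem exists_strictMono_ne_iff_eq (y : ℚ) :
    ∃ u v : ↥strictMonoEnd, ∀ p, u.1 p ≠ v.1 p ↔ p = y := by
  refine ⟨⟨fun p => if p < y then p else p + 1, fun a b hab => ?_⟩,
    ⟨fun p => if p ≤ y then p else p + 1, fun a b hab => ?_⟩, fun p => ?_⟩
  · dsimp only; split_ifs <;> linarith
  · dsimp only; split_ifs <;> linarith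
  · dsimp only; split_ifs <;> grind

/-- A strictly increasing self-map of `ℚ` whose range contains `x` can be confined to the open
interval of radius one around `x`. -/
theorem exists_strictMono_abs_sub_lt_one (x : ℚ) :
    ∃ t : ↥strictMonoEnd, (∃ q, t.1 q = x) ∧ ∀ q, |t.1 q - x| < 1 := by
  have key : ∀ q : ℚ, |q / (1 + |q|)| < 1 := fun q => by
    have := abs_nonneg q
    rw [abs_div, abs_of_pos (by linarith : 0 < 1 + |q|), div_lt_one (by linarith)]
    linarith
  refine ⟨⟨fun q => x + q / (1 + |q|), fun a b hab => ?_⟩, ⟨0, by simp⟩, fun q => by simpa using key q⟩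
  have ha := abs_nonneg a
  have hb := abs_nonneg b
  refine add_lt_add_right ((div_lt_div_iff₀ (by linarith) (by linarith)).2 ?_) x
  rcases abs_cases a with ⟨h, _⟩ | ⟨h, _⟩ <;> rcases abs_cases b with ⟨h', _⟩ | ⟨h', _⟩ <;>
    rw [h, h'] <;> nlinarith

/-- A strictly increasing self-map of `ℚ` can send `y` to `x` and avoid all other points of the
open interval of radius one around `x`. -/
theorem exists_strictMono_abs_sub_lt_one_iff (x y : ℚ) :
    ∃ v : ↥strictMonoEnd, v.1 y = x ∧ ∀ p, |v.1 p - x| < 1 → p = y := by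
  refine ⟨⟨fun p => if p < y then x + (p - y) - 1 else if p = y then x else x + (p - y) + 1,
    fun a b hab => ?_⟩, by simp, fun p hp => ?_⟩
  · dsimp only; split_ifs <;> grind
  · dsimp only at hp
    rw [abs_lt] at hp
    split_ifs at hp <;> grind

theorem isOpen_zariskiTop_exists_polyEval_eq (t : ↥strictMonoEnd) (ts : List ↥strictMonoEnd)
    (y : ℚ) :
    IsOpen[zariskiTop ℚ strictMonoEnd]
      {s : ↥strictMonoEnd | ∃ q, s.1 (polyEval t.1 (ts.map Subtype.val) s.1 q) = y} := by
  obtain ⟨u, v, huv⟩ := exists_strictMono_ne_iff_eq y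
  refine TopologicalSpace.isOpen_generateFrom_of_mem ⟨t, ts ++ [u], t, ts ++ [v], ?_⟩
  ext s
  simp [polyEval, Function.ne_iff, ← huv]

theorem isOpen_zariskiTop_eval (x y : ℚ) :
    IsOpen[zariskiTop ℚ strictMonoEnd] {s : ↥strictMonoEnd | s.1 x = y} := by
  let _ := zariskiTop ℚ strictMonoEnd
  obtain ⟨t, ⟨q₀, hq₀⟩, ht⟩ := exists_strictMono_abs_sub_lt_one x
  obtain ⟨v, hvy, hv⟩ := exists_strictMono_abs_sub_lt_one_iff x y
  have h : {s : ↥strictMonoEnd | s.1 x = y} =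
      {s | ∃ q, s.1 (polyEval t.1 (([] : List ↥strictMonoEnd).map Subtype.val) s.1 q) = y} ∩
        {s | ∃ q, s.1 (polyEval t.1 ([v].map Subtype.val) s.1 q) = y} := by
    ext s
    simp only [polyEval, List.map_nil, List.map_cons, List.foldl_nil, List.foldl_cons,
      Function.comp_apply, Set.mem_ofPred_eq, Set.mem_inter_iff]
    constructor
    · intro hs
      exact ⟨⟨q₀, by rw [hq₀, hs]⟩, ⟨q₀, by rw [hq₀, hs, hvy, hs]⟩⟩
    · rintro ⟨⟨q, hq⟩, ⟨r, hr⟩⟩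
      have hqr : t.1 q = v.1 (s.1 (t.1 r)) := s.2.injective (hq.trans hr.symm)
      have hy := hv _ (hqr ▸ ht q)
      rwa [hy, hvy] at hr
  rw [h]
  exact (isOpen_zariskiTop_exists_polyEval_eq t [] y).inter
    (isOpen_zariskiTop_exists_polyEval_eq t [v] y)

theorem strictMonoEnd_zariski_eq_pointwise :
    zariskiTop ℚ strictMonoEnd = pointwiseTop ℚ strictMonoEnd := by
  refine le_antisymm (le_generateFrom ?_) (pointwiseTop_le_zariskiTop ℚ strictMonoEnd)
  rintro _ ⟨x, y, rfl⟩
  exact isOpen_zariskiTop_eval x y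
end

section
/- Let 𝔸 be a finite relational structure and let ω𝔸 denote the disjoint union of countably infinitely many copies of 𝔸. Then every T1 topology on End(ω𝔸) which is semitopological contains the pointwise topology. -/
variable {A : Type*} {ι : Type*}

/-- The relations of the disjoint union `ω𝔸` of countably many copies of the
relational structure `(A, rel)`: a tuple is related iff all its entries lie in
the same copy and the corresponding tuple of second coordinates is related
in `𝔸`. -/
def omegaCopiesRel (ar : ι → ℕ) (rel : ∀ i, (Fin (ar i) → A) → Prop) :
    ∀ i : ι, (Fin (ar i) → ℕ × A) → Prop :=
  fun i x => (∀ k l, (x k).1 = (x l).1) ∧ rel i (fun k => (x k).2)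

/-- The endomorphism monoid of `ω𝔸`, as a set of functions. -/
def omegaCopiesEnd (ar : ι → ℕ) (rel : ∀ i, (Fin (ar i) → A) → Prop) :
    Set ((ℕ × A) → (ℕ × A)) :=
  {f | ∀ (i : ι) (x : Fin (ar i) → ℕ × A),
    omegaCopiesRel ar rel i x → omegaCopiesRel ar rel i (f ∘ x)}

theorem omegaCopiesEnd_comp (ar : ι → ℕ) (rel : ∀ i, (Fin (ar i) → A) → Prop) :
    ∀ f ∈ omegaCopiesEnd ar rel, ∀ g ∈ omegaCopiesEnd ar rel,
      g ∘ f ∈ omegaCopiesEnd ar rel :=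
  fun _ hf _ hg i x h => hg i _ (hf i x h)

/-- Reindexing the copies along `σ` is an endomorphism of `ω𝔸`. -/
theorem reindex_mem_omegaCopiesEnd (ar : ι → ℕ) (rel : ∀ i, (Fin (ar i) → A) → Prop)
    (σ : ℕ → ℕ) : (fun p : ℕ × A => (σ p.1, p.2)) ∈ omegaCopiesEnd ar rel :=
  fun _ _ h => ⟨fun k l => congrArg σ (h.1 k l), h.2⟩

/-- There are only finitely many self-maps of `ℕ × A` with values in `s × A` which
agree on all copies of `A`, when `s` and `A` are finite. -/
theorem finite_setOf_copyInvariant [Finite A] {s : Set ℕ} (hs : s.Finite) :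
    {c : ℕ × A → ℕ × A | ∀ p, c p = c (0, p.2) ∧ (c p).1 ∈ s}.Finite := by
  refine Set.Finite.of_injOn (f := fun c (a : A) => c (0, a))
    (t := Set.univ.pi fun _ => s ×ˢ (Set.univ : Set A)) ?_ ?_
    (Set.Finite.pi fun _ => hs.prod Set.finite_univ)
  · exact fun c hc a _ => ⟨(hc (0, a)).2, trivial⟩
  · intro c hc d hd h
    funext p
    rw [(hc p).1, (hd p).1]
    exact congrFun h p.2

theorem omegaCopies_T1_semitopological_contains_pointwise
    [Finite A]
    (ar : ι → ℕ) (rel : ∀ i, (Fin (ar i) → A) → Prop)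
    (τ : TopologicalSpace ↥(omegaCopiesEnd ar rel))
    (hT1 : @T1Space ↥(omegaCopiesEnd ar rel) τ)
    (hsemitop : ∀ g : ↥(omegaCopiesEnd ar rel),
      (@Continuous ↥(omegaCopiesEnd ar rel) ↥(omegaCopiesEnd ar rel) τ τ
        (fun f => ⟨f.1 ∘ g.1, omegaCopiesEnd_comp ar rel g.1 g.2 f.1 f.2⟩)) ∧
      (@Continuous ↥(omegaCopiesEnd ar rel) ↥(omegaCopiesEnd ar rel) τ τ
        (fun f => ⟨g.1 ∘ f.1, omegaCopiesEnd_comp ar rel f.1 f.2 g.1 g.2⟩))) :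
    ∀ U : Set ↥(omegaCopiesEnd ar rel),
      @IsOpen ↥(omegaCopiesEnd ar rel) (pointwiseTop (ℕ × A) (omegaCopiesEnd ar rel)) U →
      @IsOpen ↥(omegaCopiesEnd ar rel) τ U := by
  let := τ
  have := hT1
  refine fun U hU => le_generateFrom (t := τ) ?_ U hU
  rintro _ ⟨⟨i, a⟩, ⟨j, b⟩, rfl⟩
  let h : ↥(omegaCopiesEnd ar rel) := ⟨_, reindex_mem_omegaCopiesEnd ar rel fun _ => i⟩
  let g : ↥(omegaCopiesEnd ar rel) :=
    ⟨_, reindex_mem_omegaCopiesEnd ar rel fun n => if n = j then 1 else 0⟩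
  let F : Set ↥(omegaCopiesEnd ar rel) :=
    {c | (∀ p, c.1 p = c.1 (0, p.2) ∧ (c.1 p).1 ∈ ({0, 1} : Set ℕ)) ∧ c.1 (0, a) ≠ (1, b)}
  have hF : F.Finite :=
    ((finite_setOf_copyInvariant (Set.toFinite {0, 1})).preimage
      Subtype.val_injective.injOn).subset fun c hc => hc.1
  convert hF.isClosed.isOpen_compl.preimage ((hsemitop g).2.comp (hsemitop h).1) using 1
  ext f
  have key : g.1 (f.1 (h.1 (0, a))) = (1, b) ↔ f.1 (i, a) = (j, b) := by
    simp [g, h, Prod.ext_iff]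
  rw [Set.mem_ofPred_eq, ← key, Set.mem_preimage, Set.mem_compl_iff]
  constructor
  · exact fun hf hc => hc.2 hf
  · intro hf
    by_contra hne
    refine hf ⟨fun p => ⟨rfl, ?_⟩, hne⟩
    change (if _ then 1 else 0) ∈ ({0, 1} : Set ℕ)
    split_ifs <;> simp
end

section
/- For every integer n ≥ 1, the monoid End(ωKₙ), equipped with the pointwise topology, has property X with respect to the automorphism group Aut(ωKₙ). -/
variable {G : Type*}

/-- The automorphism group of the graph `(G, adj)`, as a set of functions. -/
def graphAut (adj : G → G → Prop) : Set (G → G) :=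
  {f : G → G | Function.Bijective f ∧ ∀ x y : G, (adj x y ↔ adj (f x) (f y))}

/-- Property **X** of the semigroup (of self-maps, under composition in
diagrammatic order) `S` with respect to the subset `G ⊆ S`, for the topology
`τ` on `S`. -/
def HasPropertyX {X : Type*} (S G : Set (X → X)) (τ : TopologicalSpace ↥S) : Prop :=
  ∀ s : ↥S, ∃ f g t : ↥S, t.1 ∈ G ∧
    s.1 = g.1 ∘ t.1 ∘ f.1 ∧
    ∀ B : Set ↥S, B ∈ @nhds ↥S τ t →
      {u : ↥S | ∃ b : ↥S, b ∈ B ∧ b.1 ∈ G ∧ u.1 = g.1 ∘ b.1 ∘ f.1} ∈ @nhds ↥S τ s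

open Filter in
theorem pointwiseTop_nhds_hasBasis {X : Type*} (S : Set (X → X)) (t : ↥S) :
    (@nhds ↥S (pointwiseTop X S) t).HasBasis (fun F : Set X => F.Finite)
      fun F => {f : ↥S | ∀ x ∈ F, f.1 x = t.1 x} := by
  have h : @nhds ↥S (pointwiseTop X S) t = ⨅ x : X, 𝓟 {f : ↥S | f.1 x = t.1 x} := by
    rw [pointwiseTop, TopologicalSpace.nhds_generateFrom]
    apply le_antisymm
    · exact le_iInf fun x => iInf₂_le _ ⟨rfl, x, t.1 x, rfl⟩
    · refine le_iInf₂ ?_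
      rintro _ ⟨ht, x, y, rfl⟩
      have hy : t.1 x = y := ht
      subst hy
      exact iInf_le _ x
  rw [h]
  convert hasBasis_iInf_principal_finite (fun x : X => {f : ↥S | f.1 x = t.1 x}) using 2 with F
  ext f
  simp

/-- An injection defined on a co-infinite set of natural numbers, with co-infinite image,
extends to a permutation. -/
theorem exists_perm_extending_injOn {D : Set ℕ} {h : ℕ → ℕ} (hinj : Set.InjOn h D)
    (hD : Dᶜ.Infinite) (hI : (h '' D)ᶜ.Infinite) :
    ∃ π : Equiv.Perm ℕ, ∀ k ∈ D, π k = h k := by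
  classical
  have : Infinite {x // x ∉ D} := hD.to_subtype
  have : Infinite {x // x ∉ h '' D} := hI.to_subtype
  obtain ⟨e⟩ : Nonempty ({x // x ∉ D} ≃ {x // x ∉ h '' D}) := nonempty_equiv_of_countable
  let e₀ : {x // x ∈ D} ≃ {x // x ∈ h '' D} := Equiv.Set.imageOfInjOn h D hinj
  refine ⟨Equiv.subtypeCongr e₀ e, fun k hk => ?_⟩
  simp only [Equiv.subtypeCongr, Equiv.trans_apply, Equiv.sumCompl_symm_apply_of_pos hk]
  rfl

/-- A finite part of a permutation that covers a given map `φ` on the even numbers, along the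
first projection of the pairing function, extends to a permutation covering `φ` everywhere. -/
theorem exists_perm_covering (φ : ℕ → ℕ) (π₀ : Equiv.Perm ℕ) (N : ℕ)
    (hπ₀ : ∀ i, 2 * i < N → (Nat.unpair (π₀ (2 * i))).1 = φ i) :
    ∃ π : Equiv.Perm ℕ, (∀ k < N, π k = π₀ k) ∧
      ∀ i, (Nat.unpair (π (2 * i))).1 = φ i := by
  obtain ⟨M, hM⟩ : ∃ M, ∀ k < N, π₀ k < M := by
    obtain ⟨M, hM⟩ := ((Set.finite_Iio N).image π₀).bddAbove
    exact ⟨M + 1, fun k hk => Nat.lt_succ_of_le (hM ⟨k, hk, rfl⟩)⟩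
  let D : Set ℕ := {k | k < N ∨ Even k}
  let h : ℕ → ℕ := fun k => if k < N then π₀ k else Nat.pair (φ (k / 2)) (2 * (k + M))
  have hlarge (a k : ℕ) : M ≤ Nat.pair a (2 * (k + M)) :=
    le_trans (by omega) (Nat.right_le_pair _ _)
  have hinj : Set.InjOn h D := by
    intro k _ l _ hkl
    by_cases hkN : k < N <;> by_cases hlN : l < N <;>
      simp only [h, hkN, hlN, if_true, if_false] at hkl
    · exact π₀.injective hkl
    · exact absurd (hlarge (φ (l / 2)) l) (by have := hM k hkN; omega)
    · exact absurd (hlarge (φ (k / 2)) k) (by have := hM l hlN; omega)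
    · have := (Nat.pair_eq_pair.1 hkl).2
      omega
  have hD : Dᶜ.Infinite := by
    refine Set.infinite_of_injective_forall_mem (f := fun j : ℕ => 2 * (j + N) + 1)
      (fun a b hab => by simpa using hab) fun j => ?_
    simp only [D, Set.mem_compl_iff, Set.mem_ofPred_eq, Nat.even_iff]
    omega
  have hI : (h '' D)ᶜ.Infinite := by
    refine Set.infinite_of_injective_forall_mem (f := fun j : ℕ => Nat.pair 0 (2 * (j + M) + 1))
      (fun a b hab => by simpa using hab) ?_
    rintro j ⟨k, -, hk⟩
    by_cases hkN : k < N <;> simp only [h, hkN, if_true, if_false] at hk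
    · have := hM k hkN
      have := Nat.right_le_pair 0 (2 * (j + M) + 1)
      omega
    · have := (Nat.pair_eq_pair.1 hk).2
      omega
  obtain ⟨π, hπ⟩ := exists_perm_extending_injOn hinj hD hI
  have hlow : ∀ k < N, π k = π₀ k := fun k hk => by simp [hπ k (Or.inl hk), h, hk]
  refine ⟨π, hlow, fun i => ?_⟩
  by_cases hi : 2 * i < N
  · rw [hlow _ hi, hπ₀ i hi]
  · simp [hπ (2 * i) (Or.inr (even_two_mul i)), h, hi]

/-- The self-map of `ωKₙ` permuting the components by `π`, acting on the even components as the
endomorphism `u` does and trivially on the odd ones. -/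
def omegaKnLift {n : ℕ} (π : Equiv.Perm ℕ) (u : ℕ × Fin n → ℕ × Fin n) :
    ℕ × Fin n → ℕ × Fin n :=
  fun x => (π x.1, if Even x.1 then (u (x.1 / 2, x.2)).2 else x.2)

theorem graphAut_subset_graphEnd {V : Type*} (adj : V → V → Prop) :
    graphAut adj ⊆ graphEnd adj :=
  fun _ hf x y => (hf.2 x y).1

theorem omegaKn_end_fst_eq {n : ℕ} {u : ℕ × Fin n → ℕ × Fin n} (hu : u ∈ graphEnd (omegaKn n))
    (i : ℕ) (a b : Fin n) : (u (i, a)).1 = (u (i, b)).1 := by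
  by_cases hab : a = b
  · rw [hab]
  · exact (hu (i, a) (i, b) ⟨rfl, by simpa using hab⟩).1

theorem omegaKn_end_snd_injective {n : ℕ} {u : ℕ × Fin n → ℕ × Fin n}
    (hu : u ∈ graphEnd (omegaKn n)) (i : ℕ) : Function.Injective fun a => (u (i, a)).2 := by
  intro a b hab
  by_contra hne
  obtain ⟨h₁, h₂⟩ := hu (i, a) (i, b) ⟨rfl, by simpa using hne⟩
  exact h₂ (Prod.ext h₁ hab)

theorem omegaKnLift_mem_graphAut {n : ℕ} (π : Equiv.Perm ℕ) {u : ℕ × Fin n → ℕ × Fin n}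
    (hu : u ∈ graphEnd (omegaKn n)) : omegaKnLift π u ∈ graphAut (omegaKn n) := by
  have hfib (k : ℕ) :
      Function.Injective fun a => if Even k then (u (k / 2, a)).2 else a := by
    by_cases hk : Even k
    · simpa [hk] using omegaKn_end_snd_injective hu (k / 2)
    · simp only [hk, if_false]
      exact Function.injective_id
  have hinj : Function.Injective (omegaKnLift π u) := by
    rintro ⟨k, a⟩ ⟨l, b⟩ hkl
    obtain ⟨h₁, h₂⟩ := Prod.ext_iff.1 hkl
    obtain rfl : k = l := π.injective h₁
    exact Prod.ext rfl (hfib k h₂)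
  have hsurj : Function.Surjective (omegaKnLift π u) := by
    rintro ⟨k, a⟩
    obtain ⟨b, hb⟩ := Finite.surjective_of_injective (hfib (π.symm k)) a
    exact ⟨(π.symm k, b), Prod.ext (π.apply_symm_apply k) hb⟩
  exact ⟨⟨hinj, hsurj⟩, fun x y => and_congr π.injective.eq_iff.symm hinj.ne_iff.symm⟩

theorem omegaKn_end_has_propertyX (n : ℕ) (hn : 1 ≤ n) :
    HasPropertyX (graphEnd (omegaKn n)) (graphAut (omegaKn n))
      (pointwiseTop (ℕ × Fin n) (graphEnd (omegaKn n))) := by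
  let E := graphEnd (omegaKn n)
  let f : E := ⟨fun x => (2 * x.1, x.2), fun x y h =>
    ⟨congrArg (2 * ·) h.1, fun he => h.2 (Prod.ext h.1 (Prod.ext_iff.1 he).2)⟩⟩
  let g : E := ⟨fun x => ((Nat.unpair x.1).1, x.2), fun x y h =>
    ⟨congrArg (fun k => (Nat.unpair k).1) h.1,
      fun he => h.2 (Prod.ext h.1 (Prod.ext_iff.1 he).2)⟩⟩
  let φ : E → ℕ → ℕ := fun u i => (u.1 (i, ⟨0, hn⟩)).1
  let lift : Equiv.Perm ℕ → E → E := fun π u =>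
    ⟨omegaKnLift π u.1, graphAut_subset_graphEnd _ (omegaKnLift_mem_graphAut π u.2)⟩
  have hlift (π : Equiv.Perm ℕ) (u : E)
      (hπ : ∀ i, (Nat.unpair (π (2 * i))).1 = φ u i) :
      u.1 = g.1 ∘ (lift π u).1 ∘ f.1 := by
    funext ⟨i, a⟩
    refine Prod.ext ?_ ?_
    · exact (omegaKn_end_fst_eq u.2 i a ⟨0, hn⟩).trans (hπ i).symm
    · simp [f, g, lift, omegaKnLift]
  intro s
  obtain ⟨π₀, -, hπ₀⟩ := exists_perm_covering (φ s) 1 0 (by simp)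
  refine ⟨f, g, lift π₀ s, omegaKnLift_mem_graphAut π₀ s.2, hlift π₀ s hπ₀, fun B hB => ?_⟩
  obtain ⟨F, hF, hFB⟩ := (pointwiseTop_nhds_hasBasis E (lift π₀ s)).mem_iff.1 hB
  obtain ⟨N, hN⟩ : ∃ N, ∀ x ∈ F, x.1 < N := by
    obtain ⟨N, hN⟩ := (hF.image Prod.fst).bddAbove
    exact ⟨N + 1, fun x hx => Nat.lt_succ_of_le (hN ⟨x, hx, rfl⟩)⟩
  refine (pointwiseTop_nhds_hasBasis E s).mem_iff.2
    ⟨Set.Iio N ×ˢ Set.univ, (Set.finite_Iio N).prod Set.finite_univ, fun u hu => ?_⟩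
  have hus (i : ℕ) (hi : i < N) (a : Fin n) : u.1 (i, a) = s.1 (i, a) :=
    hu (i, a) ⟨hi, trivial⟩
  obtain ⟨π, hπN, hπ⟩ := exists_perm_covering (φ u) π₀ N fun i hi => by
    rw [hπ₀ i]
    exact congrArg Prod.fst (hus i (by omega) _).symm
  refine ⟨lift π u, hFB ?_, omegaKnLift_mem_graphAut π u.2, hlift π u hπ⟩
  rintro ⟨k, a⟩ hx
  have hk : k < N := hN _ hx
  simp [lift, omegaKnLift, hπN k hk, hus (k / 2) (by omega) a]
end

section
/- The class of all finite strict partial orders (finite sets with an irreflexive transitive binary relation <, with homomorphisms being maps f such that x < y implies f(x) < f(y)) has the strong amalgamation property with homomorphism gluing. -/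
universe u

/-- `f` is an embedding of the strict order `(A, rA)` into `(B, rB)`. -/
def IsOrderEmbed {A B : Type u} (rA : A → A → Prop) (rB : B → B → Prop)
    (f : A → B) : Prop :=
  Function.Injective f ∧ ∀ x y : A, (rA x y ↔ rB (f x) (f y))

/-- The order on the free amalgam `B ⊕ (C \ e₂ A)`: the given orders on both parts, and
comparisons between the parts exactly when forced by an element of `A`. -/
def amalgamRel {A B C : Type u} (rB : B → B → Prop) (rC : C → C → Prop)
    (e₁ : A → B) (e₂ : A → C) :
    B ⊕ {c : C // c ∉ Set.range e₂} → B ⊕ {c : C // c ∉ Set.range e₂} → Prop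
  | .inl b, .inl b' => rB b b'
  | .inl b, .inr c => ∃ a, (b = e₁ a ∨ rB b (e₁ a)) ∧ rC (e₂ a) c
  | .inr c, .inl b => ∃ a, rC c (e₂ a) ∧ (e₁ a = b ∨ rB (e₁ a) b)
  | .inr c, .inr c' => rC c c'

theorem amalgamRel_irrefl {A B C : Type u} {rB : B → B → Prop} {rC : C → C → Prop}
    {e₁ : A → B} {e₂ : A → C} (hB : Irreflexive rB) (hC : Irreflexive rC) :
    Irreflexive (amalgamRel rB rC e₁ e₂)
  | .inl b => hB b
  | .inr c => hC c

theorem amalgamRel_trans {A B C : Type u} {rA : A → A → Prop} {rB : B → B → Prop}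
    {rC : C → C → Prop} {e₁ : A → B} {e₂ : A → C} (hB : Transitive rB) (hC : Transitive rC)
    (he₁ : IsOrderEmbed rA rB e₁) (he₂ : ∀ x y, rA x y ↔ rC (e₂ x) (e₂ y)) :
    Transitive (amalgamRel rB rC e₁ e₂) := by
  have tB : ∀ x y z, rB x y → rB y z → rB x z := fun _ _ _ => @hB _ _ _
  have tC : ∀ x y z, rC x y → rC y z → rC x z := fun _ _ _ => @hC _ _ _
  have h₁₂ : ∀ x y, rB (e₁ x) (e₁ y) ↔ rC (e₂ x) (e₂ y) := fun x y =>
    (he₁.2 x y).symm.trans (he₂ x y)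
  have i₁ : ∀ x y, e₁ x = e₁ y → x = y := fun _ _ => @he₁.1 _ _
  clear he₁ he₂
  rintro (b | c) (b' | c') (b'' | c'') h h' <;> simp only [amalgamRel] at h h' ⊢ <;> grind

/-- The inclusion of `C` into the free amalgam `B ⊕ (C \ e₂ A)`. -/
noncomputable def amalgamInr {A B C : Type u} (e₁ : A → B) (e₂ : A → C) (c : C) :
    B ⊕ {c : C // c ∉ Set.range e₂} :=
  open Classical in
  if h : c ∈ Set.range e₂ then .inl (e₁ h.choose) else .inr ⟨c, h⟩

theorem amalgamInr_apply {A B C : Type u} (e₁ : A → B) {e₂ : A → C}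
    (he₂ : Function.Injective e₂) (a : A) : amalgamInr e₁ e₂ (e₂ a) = .inl (e₁ a) := by
  have h : e₂ a ∈ Set.range e₂ := ⟨a, rfl⟩
  rw [amalgamInr, dif_pos h, he₂ h.choose_spec]

theorem amalgamInr_of_notMem {A B C : Type u} (e₁ : A → B) {e₂ : A → C} {c : C}
    (h : c ∉ Set.range e₂) : amalgamInr e₁ e₂ c = .inr ⟨c, h⟩ :=
  dif_neg h

theorem amalgamInr_isOrderEmbed {A B C : Type u} {rA : A → A → Prop} {rB : B → B → Prop}
    {rC : C → C → Prop} {e₁ : A → B} {e₂ : A → C} (hC : Transitive rC)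
    (he₁ : IsOrderEmbed rA rB e₁) (he₂ : IsOrderEmbed rA rC e₂) :
    IsOrderEmbed rC (amalgamRel rB rC e₁ e₂) (amalgamInr e₁ e₂) := by
  have tC : ∀ x y z, rC x y → rC y z → rC x z := fun _ _ _ => @hC _ _ _
  obtain ⟨i₁, h₁⟩ := he₁
  obtain ⟨i₂, h₂⟩ := he₂
  refine ⟨fun c c' h => ?_, fun c c' => ?_⟩ <;>
    rcases em (c ∈ Set.range e₂) with ⟨a, rfl⟩ | hc <;>
    rcases em (c' ∈ Set.range e₂) with ⟨a', rfl⟩ | hc'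
  · simp only [amalgamInr_apply e₁ i₂, Sum.inl.injEq] at h
    rw [i₁ h]
  · simp [amalgamInr_apply e₁ i₂, amalgamInr_of_notMem e₁ hc'] at h
  · simp [amalgamInr_apply e₁ i₂, amalgamInr_of_notMem e₁ hc] at h
  · simpa [amalgamInr_of_notMem e₁ hc, amalgamInr_of_notMem e₁ hc'] using h
  · rw [amalgamInr_apply e₁ i₂, amalgamInr_apply e₁ i₂]
    exact (h₂ a a').symm.trans (h₁ a a')
  · rw [amalgamInr_apply e₁ i₂, amalgamInr_of_notMem e₁ hc']
    refine ⟨fun h => ⟨a, .inl rfl, h⟩, ?_⟩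
    rintro ⟨x, hx | hx, h⟩
    · rwa [i₁ hx]
    · exact tC _ _ _ ((h₂ a x).1 ((h₁ a x).2 hx)) h
  · rw [amalgamInr_apply e₁ i₂, amalgamInr_of_notMem e₁ hc]
    refine ⟨fun h => ⟨a', h, .inl rfl⟩, ?_⟩
    rintro ⟨x, h, hx | hx⟩
    · rwa [← i₁ hx]
    · exact tC _ _ _ h ((h₂ x a').1 ((h₁ x a').2 hx))
  · rw [amalgamInr_of_notMem e₁ hc, amalgamInr_of_notMem e₁ hc']
    rfl

/-- The class of finite strict partial orders has the strong amalgamation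
property with homomorphism gluing. -/
theorem finite_strict_orders_SAHG
    (A B C : Type u) (rA : A → A → Prop) (rB : B → B → Prop) (rC : C → C → Prop)
    (hA : Finite A) (hAirr : Irreflexive rA) (hAtr : Transitive rA)
    (hB : Finite B) (hBirr : Irreflexive rB) (hBtr : Transitive rB)
    (hC : Finite C) (hCirr : Irreflexive rC) (hCtr : Transitive rC)
    (e₁ : A → B) (e₂ : A → C)
    (he₁ : IsOrderEmbed rA rB e₁) (he₂ : IsOrderEmbed rA rC e₂) :
    ∃ (D : Type u) (rD : D → D → Prop),
      Finite D ∧ Irreflexive rD ∧ Transitive rD ∧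
      ∃ (f₁ : B → D) (f₂ : C → D),
        IsOrderEmbed rB rD f₁ ∧ IsOrderEmbed rC rD f₂ ∧
        (∀ a : A, f₁ (e₁ a) = f₂ (e₂ a)) ∧
        (Set.range f₁ ∩ Set.range f₂ = Set.range (f₁ ∘ e₁)) ∧
        ∀ (E : Type u) (rE : E → E → Prop),
          Finite E → Irreflexive rE → Transitive rE →
          ∀ (Dom : Set D) (g : D → E),
            Set.range (f₁ ∘ e₁) ⊆ Dom →
            (∀ b b' : B, f₁ b ∈ Dom → f₁ b' ∈ Dom → rB b b' →
              rE (g (f₁ b)) (g (f₁ b'))) →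
            (∀ c c' : C, f₂ c ∈ Dom → f₂ c' ∈ Dom → rC c c' →
              rE (g (f₂ c)) (g (f₂ c'))) →
            ∀ d d' : D, d ∈ Dom → d' ∈ Dom → rD d d' → rE (g d) (g d') := by
  have app := amalgamInr_apply e₁ he₂.1
  refine ⟨B ⊕ {c : C // c ∉ Set.range e₂}, amalgamRel rB rC e₁ e₂, inferInstance,
    amalgamRel_irrefl hBirr hCirr, amalgamRel_trans hBtr hCtr he₁ he₂.2,
    Sum.inl, amalgamInr e₁ e₂, ⟨Sum.inl_injective, fun _ _ => Iff.rfl⟩,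
    amalgamInr_isOrderEmbed hCtr he₁ he₂, fun a => (app a).symm, ?_, ?_⟩
  · ext d
    constructor
    · rintro ⟨⟨b, rfl⟩, c, hc⟩
      rcases em (c ∈ Set.range e₂) with ⟨a, rfl⟩ | h
      · exact ⟨a, (app a).symm.trans hc⟩
      · simp [amalgamInr_of_notMem e₁ h] at hc
    · rintro ⟨a, rfl⟩
      exact ⟨⟨e₁ a, rfl⟩, e₂ a, app a⟩
  · intro E rE _ _ hEtr Dom g hDom hgB hgC
    have mem (a : A) : Sum.inl (e₁ a) ∈ Dom := hDom ⟨a, rfl⟩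
    have mem' (a : A) : amalgamInr e₁ e₂ (e₂ a) ∈ Dom := app a ▸ mem a
    have inr (c : {c : C // c ∉ Set.range e₂}) : amalgamInr e₁ e₂ c = .inr c :=
      amalgamInr_of_notMem e₁ c.2
    rintro (b | c) (b' | c') hd hd' h
    · exact hgB b b' hd hd' h
    · obtain ⟨a, hb, hc⟩ := h
      have key := hgC (e₂ a) c' (mem' a) (inr c' ▸ hd') hc
      rw [app, inr] at key
      rcases hb with rfl | hb
      · exact key
      · exact hEtr (hgB b (e₁ a) hd (mem a) hb) key
    · obtain ⟨a, hc, hb⟩ := h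
      have key := hgC c (e₂ a) (inr c ▸ hd) (mem' a) hc
      rw [app, inr] at key
      rcases hb with rfl | hb
      · exact key
      · exact hEtr key (hgB (e₁ a) b' (mem a) hd' hb)
    · have key := hgC c c' (inr c ▸ hd) (inr c' ▸ hd') h
      rwa [inr, inr] at key
end
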